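/- arXiv:2404.18447 — 8 statements merged into one kernel-verified Lean document; each statement's English description precedes it below -/
import Mathlib

section
/- For every natural number k ≥ 1 and every coefficient family φ : (Fin (k+1) → Fin 2) → ℂ, there exists a ℂ-multilinear map T from (Fin k → (Fin 2 → ℂ)) to (Fin 2 → ℂ) (multilinear in its k vector arguments) such that for every family v : Fin k → (Fin 2 → ℂ) one has ∑_{I : Fin (k+1) → Fin 2} φ I * (∏_{j : Fin k} v j (I (Fin.castSucc j))) * (T v) (I (Fin.last k)) = 0. In other words, the (k+1)-linear constraint form determined by φ can always be annihilated by computing the last qubit's state from the first k qubit states via a multilinear transfer map (Bravyi's transfer matrix, generalized to arity k+1). -/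
open Finset

/-- The multilinear form in the first `k` qubit states obtained from the constraint `φ` by fixing
the last qubit to the basis state `b`. -/
noncomputable def constraintSlice {k : ℕ} (φ : (Fin (k + 1) → Fin 2) → ℂ) (b : Fin 2) :
    MultilinearMap ℂ (fun _ : Fin k => (Fin 2 → ℂ)) ℂ :=
  ∑ J : Fin k → Fin 2, φ (Fin.snoc J b) •
    (MultilinearMap.mkPiAlgebra ℂ (Fin k) ℂ).compLinearMap fun j => LinearMap.proj (J j)

theorem constraintSlice_apply {k : ℕ} (φ : (Fin (k + 1) → Fin 2) → ℂ) (b : Fin 2)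
    (v : Fin k → (Fin 2 → ℂ)) :
    constraintSlice φ b v = ∑ J : Fin k → Fin 2, φ (Fin.snoc J b) * ∏ j, v j (J j) := by
  simp [constraintSlice]

/-- The constraint form splits along the basis states of the last qubit. -/
theorem sum_constraint_eq_sum_constraintSlice {k : ℕ} (φ : (Fin (k + 1) → Fin 2) → ℂ)
    (v : Fin k → (Fin 2 → ℂ)) (w : Fin 2 → ℂ) :
    ∑ I : Fin (k + 1) → Fin 2,
      φ I * (∏ j : Fin k, v j (I (Fin.castSucc j))) * w (I (Fin.last k)) =
        ∑ b, constraintSlice φ b v * w b := by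
  rw [← (Fin.snocEquiv fun _ : Fin (k + 1) => Fin 2).sum_comp, Fintype.sum_prod_type]
  simp [Fin.snocEquiv, constraintSlice_apply, Finset.sum_mul]

/-- Bravyi's transfer matrix, generalized to arity `k+1`: for any coefficient family
`φ` of a `(k+1)`-local constraint, there is a multilinear transfer map `T` computing
the last qubit's state from the first `k` qubit states so that the constraint form
is annihilated. -/
theorem bravyi_transfer_matrix (k : ℕ) (hk : 1 ≤ k)
    (φ : (Fin (k + 1) → Fin 2) → ℂ) :
    ∃ T : MultilinearMap ℂ (fun _ : Fin k => (Fin 2 → ℂ)) (Fin 2 → ℂ),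
      ∀ v : Fin k → (Fin 2 → ℂ),
        ∑ I : Fin (k + 1) → Fin 2,
          φ I * (∏ j : Fin k, v j (I (Fin.castSucc j))) * (T v) (I (Fin.last k)) = 0 := by
  refine ⟨MultilinearMap.pi ![constraintSlice φ 1, -constraintSlice φ 0], fun v => ?_⟩
  rw [sum_constraint_eq_sum_constraintSlice]
  simp [Fin.sum_univ_two, mul_comm]
end

section
/- Consider a k-QSAT polynomial system with M clauses on N variables given by a neighborhood map e : Fin M → Fin k → Fin N with e m injective for every m, and arbitrary coefficients φ : Fin M → ((Fin k → Fin 2) → ℂ). Suppose there exists a map v : Fin M → Fin N such that for every t : Fin M, v t ∈ Set.range (e t), and for all s, t : Fin M with t < s, v t ∉ Set.range (e s) (a leaf-removal elimination ordering, equivalently an empty 2-core). Then there exists an assignment w : Fin N → (Fin 2 → ℂ) with w n ≠ 0 for every n such that every clause is satisfied: for all m : Fin M, ∑_{i : Fin k → Fin 2} φ m i * ∏_{j : Fin k} w (e m j) (i j) = 0. -/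
open Finset

/-- A clause can be satisfied by changing the state of any single one of its qubits. -/
lemma exists_update_clause_eq_zero {κ ν : Type*} [Fintype κ] [DecidableEq κ] [DecidableEq ν]
    {e : κ → ν} (he : Function.Injective e) (φ : (κ → Fin 2) → ℂ) (w : ν → Fin 2 → ℂ) (j₀ : κ) :
    ∃ u : Fin 2 → ℂ, u ≠ 0 ∧
      ∑ i : κ → Fin 2, φ i * ∏ j, Function.update w (e j₀) u (e j) (i j) = 0 := by
  let L : (Fin 2 → ℂ) →ₗ[ℂ] ℂ :=
    ∑ i : κ → Fin 2, (φ i * ∏ j ∈ univ.erase j₀, w (e j) (i j)) • LinearMap.proj (i j₀)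
  have hL : LinearMap.ker L ≠ ⊥ := LinearMap.ker_ne_bot_of_finrank_lt (by simp)
  obtain ⟨u, hu, hu0⟩ := Submodule.exists_mem_ne_zero_of_ne_bot hL
  refine ⟨u, hu0, ?_⟩
  rw [← LinearMap.mem_ker.mp hu, LinearMap.sum_apply]
  refine sum_congr rfl fun i _ ↦ ?_
  have hprod : ∏ j ∈ univ.erase j₀, Function.update w (e j₀) u (e j) (i j) =
      ∏ j ∈ univ.erase j₀, w (e j) (i j) :=
    prod_congr rfl fun j hj ↦ by
      rw [Function.update_of_ne (he.ne (ne_of_mem_erase hj))]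
  rw [← mul_prod_erase univ _ (mem_univ j₀), hprod, Function.update_self,
    LinearMap.smul_apply, LinearMap.proj_apply, smul_eq_mul]
  ring

/-- If a k-QSAT system admits a leaf-removal elimination ordering (empty 2-core),
then it has a nonvanishing product-state solution. -/
theorem prodsat_of_leaf_removal (k M N : ℕ) (hk : 0 < k) (hM : 0 < M) (hN : 0 < N)
    (e : Fin M → Fin k → Fin N) (he : ∀ m, Function.Injective (e m))
    (φ : Fin M → ((Fin k → Fin 2) → ℂ))
    (v : Fin M → Fin N)
    (hv1 : ∀ t : Fin M, v t ∈ Set.range (e t))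
    (hv2 : ∀ s t : Fin M, t < s → v t ∉ Set.range (e s)) :
    ∃ w : Fin N → (Fin 2 → ℂ), (∀ n, w n ≠ 0) ∧
      ∀ m : Fin M, ∑ i : Fin k → Fin 2, φ m i * ∏ j : Fin k, w (e m j) (i j) = 0 := by
  suffices h : ∀ c ≤ M, ∃ w : Fin N → (Fin 2 → ℂ), (∀ n, w n ≠ 0) ∧
      ∀ m : Fin M, c ≤ m →
        ∑ i : Fin k → Fin 2, φ m i * ∏ j : Fin k, w (e m j) (i j) = 0 by
    obtain ⟨w, hw, hsat⟩ := h 0 (Nat.zero_le M)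
    exact ⟨w, hw, fun m ↦ hsat m (Nat.zero_le _)⟩
  intro c hc
  induction hc using Nat.decreasingInduction with
  | self => exact ⟨fun _ _ ↦ 1, fun _ h ↦ one_ne_zero (congrFun h 0),
      fun m hm ↦ absurd m.isLt hm.not_gt⟩
  | of_succ c hc ih =>
    obtain ⟨w, hw, hsat⟩ := ih
    obtain ⟨j₀, hj₀⟩ := hv1 ⟨c, hc⟩
    obtain ⟨u, hu, hclause⟩ := exists_update_clause_eq_zero (he ⟨c, hc⟩) (φ ⟨c, hc⟩) w j₀
    rw [hj₀] at hclause
    refine ⟨Function.update w (v ⟨c, hc⟩) u, fun n ↦ ?_, fun m hm ↦ ?_⟩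
    · obtain rfl | hn := eq_or_ne n (v ⟨c, hc⟩)
      · rwa [Function.update_self]
      · rw [Function.update_of_ne hn]
        exact hw n
    · obtain hcm | hcm := hm.eq_or_lt
      · obtain rfl : m = ⟨c, hc⟩ := Fin.ext hcm.symm
        exact hclause
      · have hne (j : Fin k) : e m j ≠ v ⟨c, hc⟩ := fun h ↦ hv2 m ⟨c, hc⟩ hcm ⟨j, h⟩
        simp only [Function.update_of_ne (hne _)]
        exact hsat m hcm
end

section
/- Let n ≥ 1 and let R : Fin n → Fin n → Prop be a decidable relation. For volume-almost every a : Fin n → Fin n → ℂ (with respect to the Lebesgue product measure), the determinant of the matrix with entries (fun i j => if R i j then a i j else 0) is nonzero if and only if there exists a permutation σ of Fin n with R i (σ i) for every i. That is, with probability one the Jacobian matrix at the origin is invertible exactly when the underlying bipartite pattern admits a perfect matching (a clause-covering dimer configuration). -/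
open MeasureTheory

namespace Matrix

/-- If `A` is invertible, then only finitely many matrices `t • A + B` are singular. -/
theorem finite_setOf_det_smul_add_eq_zero {ι K : Type*} [Fintype ι] [DecidableEq ι] [Field K]
    {A : Matrix ι ι K} (hA : A.det ≠ 0) (B : Matrix ι ι K) :
    {t : K | (t • A + B).det = 0}.Finite := by
  set p : Polynomial K :=
    det ((Polynomial.X : Polynomial K) • A.map Polynomial.C + B.map Polynomial.C) with hp
  have hp0 : p ≠ 0 := by
    intro h
    apply hA
    rw [← Polynomial.coeff_det_X_add_C_card A B, ← hp, h, Polynomial.coeff_zero]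
  refine (Polynomial.finite_setOfPred_isRoot hp0).subset fun t ht => ?_
  have heval : p.eval t = (t • A + B).det := by
    rw [hp, ← Polynomial.coe_evalRingHom, RingHom.map_det]
    congr 1
    ext i j
    simp [mul_comm t]
  exact heval.trans ht

/-- A matrix with nonzero determinant has a transversal of nonzero entries. -/
theorem exists_perm_forall_ne_zero_of_det_ne_zero {ι S : Type*} [Fintype ι] [DecidableEq ι]
    [CommRing S] {A : Matrix ι ι S} (hA : A.det ≠ 0) :
    ∃ σ : Equiv.Perm ι, ∀ i, A i (σ i) ≠ 0 := by
  rw [← det_transpose, det_apply] at hA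
  obtain ⟨σ, -, hσ⟩ := Finset.exists_ne_zero_of_sum_ne_zero hA
  refine ⟨σ, fun i hi => hσ ?_⟩
  rw [Finset.prod_eq_zero (Finset.mem_univ i) (by simpa using hi), smul_zero]

/-- If some matrix supported on the pattern `R` is invertible, then almost all are. -/
theorem ae_det_ite_ne_zero {ι : Type*} [Fintype ι] [DecidableEq ι]
    (R : ι → ι → Prop) [DecidableRel R] {b : ι → ι → ℂ}
    (hb : (of fun i j => if R i j then b i j else 0).det ≠ 0) :
    ∀ᵐ a : ι → ι → ℂ, (of fun i j => if R i j then a i j else 0).det ≠ 0 := by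
  have hcont : Continuous fun a : ι → ι → ℂ =>
      (of fun i j => if R i j then a i j else 0).det := by
    refine Continuous.matrix_det (continuous_matrix fun i j => ?_)
    by_cases h : R i j
    · simpa [h] using by fun_prop
    · simpa [h] using continuous_const
  have : (volume : Measure (ι → ι → ℂ)).IsAddHaarMeasure := Measure.pi.isAddHaarMeasure _
  refine ae_mem_of_ae_add_linearMap_mem (LinearMap.toSpanSingleton ℝ (ι → ι → ℂ) b)
    (volume : Measure ℝ) volume
    (s := {a | (of fun i j => if R i j then a i j else 0).det ≠ 0})
    (isOpen_ne_fun hcont continuous_const).measurableSet fun a => ?_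
  have hfin := (finite_setOf_det_smul_add_eq_zero hb
    (of fun i j => if R i j then a i j else 0)).preimage Complex.ofReal_injective.injOn
  filter_upwards [hfin.countable.ae_notMem volume] with t ht h0
  refine ht ((congrArg det ?_).trans h0)
  ext i j
  by_cases h : R i j <;> simp [h, add_comm]

end Matrix

/-- For almost every choice of entries, the matrix supported on the pattern `R` has
nonzero determinant exactly when the pattern admits a perfect matching. -/
theorem det_ne_zero_ae_iff_matching (n : ℕ) (hn : 1 ≤ n)
    (R : Fin n → Fin n → Prop) [DecidableRel R] :
    ∀ᵐ a : Fin n → Fin n → ℂ ∂volume,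
      (Matrix.det (Matrix.of fun i j => if R i j then a i j else 0) ≠ 0
        ↔ ∃ σ : Equiv.Perm (Fin n), ∀ i : Fin n, R i (σ i)) := by
  by_cases hR : ∃ σ : Equiv.Perm (Fin n), ∀ i, R i (σ i)
  · obtain ⟨σ, hσ⟩ := hR
    have hperm : (Matrix.of fun i j => if R i j then σ.permMatrix ℂ i j else 0)
        = σ.permMatrix ℂ := by
      ext i j
      by_cases h : R i j
      · simp [h]
      · have hne : σ i ≠ j := fun hij => h (hij ▸ hσ i)
        simp [h, PEquiv.toMatrix_apply, hne]
    have hdet : (Matrix.of fun i j => if R i j then σ.permMatrix ℂ i j else 0).det ≠ 0 := by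
      rw [hperm, Matrix.det_permutation]
      exact_mod_cast (Equiv.Perm.sign σ).ne_zero
    filter_upwards [Matrix.ae_det_ite_ne_zero R hdet] with a ha
    exact iff_of_true ha ⟨σ, hσ⟩
  · refine Filter.Eventually.of_forall fun a => iff_of_false (fun ha => hR ?_) hR
    obtain ⟨σ, hσ⟩ := Matrix.exists_perm_forall_ne_zero_of_det_ne_zero ha
    exact ⟨σ, fun i => by_contra fun h => hσ i (by simp [h])⟩
end

section
/- Consider a k-QSAT polynomial system with M clauses on N variables given by a neighborhood map e : Fin M → Fin k → Fin N with e m injective for every m, and suppose it admits a clause-covering dimer configuration, i.e., an injective map μ : Fin M → Fin N with, for every m, some j : Fin k such that e m j = μ m. Then for volume-almost every choice of the non-constant coefficients ψ : Fin M → ({i : Fin k → Fin 2 // i ≠ (fun _ => 0)} → ℂ) there exists ε > 0 such that for every family of constant terms c : Fin M → ℂ with ‖c m‖ < ε for all m, there exists z : Fin N → ℂ satisfying all clauses: for every m, c m + ∑_{i : Fin k → Fin 2, i ≠ 0} ψ m i * ∏_{j : Fin k} (z (e m j)) ^ ((i j : ℕ)) = 0. -/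
open MeasureTheory

/-- A linear pencil of matrices which takes the value `1` is almost everywhere invertible. -/
theorem ae_det_ne_zero_of_map_eq_one {V n : Type*} [NormedAddCommGroup V] [NormedSpace ℝ V]
    [FiniteDimensional ℝ V] [MeasurableSpace V] [BorelSpace V] (ν : Measure V)
    [ν.IsAddHaarMeasure] [Fintype n] [DecidableEq n] (L : V →ₗ[ℝ] Matrix n n ℂ) (v : V)
    (hv : L v = 1) : ∀ᵐ x ∂ν, (L x).det ≠ 0 := by
  have hcont : Continuous fun x => (L x).det :=
    L.continuous_of_finiteDimensional.matrix_det
  refine ae_mem_of_ae_add_linearMap_mem (LinearMap.toSpanSingleton ℝ V v) (volume : Measure ℝ) ν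
    (s := {x | (L x).det ≠ 0}) (isOpen_ne_fun hcont continuous_const).measurableSet fun x => ?_
  have hfin : {t : ℝ | (t : ℂ) ∈ (-L x).charpoly.roots.toFinset}.Finite :=
    (Finset.finite_toSet _).preimage Complex.ofReal_injective.injOn
  refine measure_mono_null (fun t ht => ?_) (hfin.measure_zero volume)
  have hdet : (L x + (t : ℂ) • (1 : Matrix n n ℂ)).det = 0 := by
    simpa [hv] using ht
  simp only [Set.mem_ofPred_eq, Multiset.mem_toFinset]
  rw [Polynomial.mem_roots (Matrix.charpoly_monic _).ne_zero, Polynomial.IsRoot,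
    Matrix.eval_charpoly, ← hdet, sub_neg_eq_add, add_comm, Matrix.smul_one_eq_diagonal]
  rfl

/-- The derivative at `0` of the multilinear monomial `z ↦ ∏ j, z (f j) ^ i j`. -/
noncomputable def monomialDeriv {ι κ : Type*} [Fintype ι] [DecidableEq ι] [Fintype κ]
    (f : ι → κ) (i : ι → Fin 2) : (κ → ℂ) →L[ℂ] ℂ :=
  ∑ j, (∏ l ∈ Finset.univ.erase j, (0 : ℂ) ^ (i l : ℕ)) •
    ((i j : ℕ) : ℂ) • ContinuousLinearMap.proj (f j)

theorem hasStrictFDerivAt_monomial {ι κ : Type*} [Fintype ι] [DecidableEq ι] [Fintype κ]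
    (f : ι → κ) (i : ι → Fin 2) :
    HasStrictFDerivAt (fun z : κ → ℂ => ∏ j, z (f j) ^ (i j : ℕ)) (monomialDeriv f i) 0 := by
  have h : ∀ j ∈ Finset.univ, HasStrictFDerivAt (fun z : κ → ℂ => z (f j) ^ (i j : ℕ))
      (((i j : ℕ) : ℂ) • ContinuousLinearMap.proj (f j) : (κ → ℂ) →L[ℂ] ℂ) 0 := by
    intro j _
    generalize i j = b
    fin_cases b
    · simpa using (hasStrictFDerivAt_const (𝕜 := ℂ) (1 : ℂ) (0 : κ → ℂ)).congr_fderiv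
        (show 0 = (0 : ℂ) • ContinuousLinearMap.proj (f j) by ext; simp)
    · simpa using hasStrictFDerivAt_apply (𝕜 := ℂ) (f j) (0 : κ → ℂ)
  simpa [monomialDeriv] using HasStrictFDerivAt.finsetProd h

theorem monomialDeriv_single {ι κ : Type*} [Fintype ι] [DecidableEq ι] [Fintype κ]
    (f : ι → κ) (j : ι) :
    monomialDeriv f (Pi.single j 1) = ContinuousLinearMap.proj (f j) := by
  rw [monomialDeriv, Finset.sum_eq_single j]
  · rw [Finset.prod_eq_one]
    · simp
    · intro l hl
      simp [Pi.single_eq_of_ne (Finset.ne_of_mem_erase hl)]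
  · intro l _ hl
    ext
    simp [Pi.single_eq_of_ne hl]
  · simp

/-- A map vanishing at `0` with surjective strict derivative there attains all small values. -/
theorem HasStrictFDerivAt.exists_add_eq_zero {E ι : Type*} [NormedAddCommGroup E]
    [NormedSpace ℂ E] [CompleteSpace E] [Fintype ι] {F : E → ι → ℂ} {F' : E →L[ℂ] ι → ℂ}
    (hF : HasStrictFDerivAt F F' 0) (hF0 : F 0 = 0) (hsurj : Function.Surjective F') :
    ∃ ε > (0 : ℝ), ∀ c : ι → ℂ, (∀ m, ‖c m‖ < ε) → ∃ z, ∀ m, c m + F z m = 0 := by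
  have hmap := hF.map_nhds_eq_of_surj (LinearMap.range_eq_top.2 hsurj)
  rw [hF0] at hmap
  have hrange : Set.range F ∈ nhds (0 : ι → ℂ) := hmap ▸ Filter.range_mem_map
  obtain ⟨ε, hε, hball⟩ := Metric.mem_nhds_iff.1 hrange
  refine ⟨ε, hε, fun c hc => ?_⟩
  obtain ⟨z, hz⟩ := hball (show -c ∈ Metric.ball 0 ε by
    simpa [pi_norm_lt_iff hε] using hc)
  exact ⟨z, fun m => by simp [hz]⟩

/-- The linear part of the system at `0`, restricted to the variables selected by `μ`, as a
linear function of the non-constant coefficients. -/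
noncomputable def linearPart {k M N : ℕ} (e : Fin M → Fin k → Fin N) (μ : Fin M → Fin N) :
    (Fin M → ({i : Fin k → Fin 2 // i ≠ fun _ => 0} → ℂ)) →ₗ[ℝ] Matrix (Fin M) (Fin M) ℂ where
  toFun ψ := Matrix.of fun m n => ∑ i, ψ m i * monomialDeriv (e m) i.1 (Pi.single (μ n) 1)
  map_add' ψ ψ' := by
    ext m n
    simp [add_mul, Finset.sum_add_distrib]
  map_smul' t ψ := by
    ext m n
    simp [Finset.mul_sum, mul_assoc]

theorem linearPart_apply {k M N : ℕ} (e : Fin M → Fin k → Fin N) (μ : Fin M → Fin N)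
    (ψ : Fin M → ({i : Fin k → Fin 2 // i ≠ fun _ => 0} → ℂ)) (m n : Fin M) :
    linearPart e μ ψ m n = ∑ i, ψ m i * monomialDeriv (e m) i.1 (Pi.single (μ n) 1) :=
  rfl

/-- A clause-covering dimer configuration provides coefficients with identity linear part. -/
theorem exists_linearPart_eq_one {k M N : ℕ} (e : Fin M → Fin k → Fin N) (μ : Fin M → Fin N)
    (hμ : Function.Injective μ) (hcov : ∀ m : Fin M, ∃ j : Fin k, e m j = μ m) :
    ∃ ψ, linearPart e μ ψ = 1 := by
  choose j hj using hcov
  have hne : ∀ m, (Pi.single (j m) 1 : Fin k → Fin 2) ≠ fun _ => 0 := fun m h => by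
    simpa using congrFun h (j m)
  refine ⟨fun m => Pi.single ⟨Pi.single (j m) 1, hne m⟩ 1, ?_⟩
  ext m n
  rw [linearPart_apply, Finset.sum_eq_single ⟨Pi.single (j m) 1, hne m⟩]
  · simp [monomialDeriv_single, hj, Matrix.one_apply, Pi.single_apply, hμ.eq_iff]
  · intro i _ hi
    simp [Pi.single_eq_of_ne hi]
  · simp

/-- If a k-QSAT system admits a clause-covering dimer configuration, then for almost
every choice of the non-constant coefficients there is an `ε > 0` such that any
perturbation by constant terms smaller than `ε` still has a solution. -/
theorem prodsat_small_constant_terms (k M N : ℕ) (hk : 0 < k) (hM : 0 < M) (hN : 0 < N)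
    (e : Fin M → Fin k → Fin N) (he : ∀ m, Function.Injective (e m))
    (μ : Fin M → Fin N) (hμ : Function.Injective μ)
    (hcov : ∀ m : Fin M, ∃ j : Fin k, e m j = μ m) :
    ∀ᵐ ψ : Fin M → ({i : Fin k → Fin 2 // i ≠ fun _ => 0} → ℂ) ∂volume,
      ∃ ε > (0 : ℝ), ∀ c : Fin M → ℂ, (∀ m : Fin M, ‖c m‖ < ε) →
        ∃ z : Fin N → ℂ, ∀ m : Fin M,
          c m + ∑ i : {i : Fin k → Fin 2 // i ≠ fun _ => 0},
            ψ m i * ∏ j : Fin k, (z (e m j)) ^ ((i.val j : ℕ)) = 0 := by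
  obtain ⟨ψ₀, hψ₀⟩ := exists_linearPart_eq_one e μ hμ hcov
  have hinner : (volume : Measure ({i : Fin k → Fin 2 // i ≠ fun _ => 0} → ℂ)).IsAddHaarMeasure :=
    inferInstance
  have hvol : (volume : Measure
      (Fin M → ({i : Fin k → Fin 2 // i ≠ fun _ => 0} → ℂ))).IsAddHaarMeasure :=
    Measure.pi.isAddHaarMeasure _
  filter_upwards [ae_det_ne_zero_of_map_eq_one volume (linearPart e μ) ψ₀ hψ₀] with ψ hψ
  have hderiv : HasStrictFDerivAt
      (fun (z : Fin N → ℂ) (m : Fin M) => ∑ i : {i : Fin k → Fin 2 // i ≠ fun _ => 0},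
        ψ m i * ∏ j : Fin k, (z (e m j)) ^ ((i.val j : ℕ)))
      (ContinuousLinearMap.pi fun m => ∑ i, ψ m i • monomialDeriv (e m) i.1) 0 :=
    hasStrictFDerivAt_pi.2 fun m => HasStrictFDerivAt.fun_sum fun i _ =>
      (hasStrictFDerivAt_monomial (e m) i.1).const_mul (ψ m i)
  refine hderiv.exists_add_eq_zero ?_ fun y => ?_
  · ext m
    refine Finset.sum_eq_zero fun i _ => ?_
    obtain ⟨j, hj⟩ := Function.ne_iff.1 i.2
    rw [Finset.prod_eq_zero (Finset.mem_univ j), mul_zero]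
    exact zero_pow (Fin.val_ne_zero_iff.2 hj)
  · obtain ⟨w, rfl⟩ := (Matrix.mulVec_surjective_iff_isUnit.2
      ((Matrix.isUnit_iff_isUnit_det _).2 hψ.isUnit)) y
    refine ⟨∑ n, w n • Pi.single (μ n) 1, ?_⟩
    ext m
    simp only [ContinuousLinearMap.pi_apply, map_sum, map_smul, sum_apply,
      smul_apply, smul_eq_mul, Matrix.mulVec, dotProduct, linearPart_apply]
    exact Finset.sum_congr rfl fun n _ => mul_comm _ _
end

section
/- Consider a k-QSAT polynomial system with M clauses on N variables given by a neighborhood map e : Fin M → Fin k → Fin N with e m injective for every m, and suppose it admits a clause-covering dimer configuration, i.e., an injective map μ : Fin M → Fin N with, for every m, some j : Fin k such that e m j = μ m. Then for volume-almost every choice of coefficients φ : Fin M → ((Fin k → Fin 2) → ℂ), there exists z : Fin N → ℂ such that for every m : Fin M, ∑_{i : Fin k → Fin 2} φ m i * ∏_{j : Fin k} (z (e m j)) ^ ((i j : ℕ)) = 0. -/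
open MeasureTheory

namespace MvPolynomial

/-- The zero set of a nonzero complex polynomial in finitely many variables is a null set. -/
theorem ae_eval_ne_zero_fin {n : ℕ} {p : MvPolynomial (Fin n) ℂ} (hp : p ≠ 0) :
    ∀ᵐ x : Fin n → ℂ, eval x p ≠ 0 := by
  induction n with
  | zero =>
    refine .of_forall fun x hx ↦ hp ?_
    rw [eq_C_of_isEmpty p, eval_C] at hx
    rw [eq_C_of_isEmpty p, hx, C_0]
  | succ n ih =>
    set q := finSuccEquiv ℂ n p with hq
    have hq0 : q ≠ 0 := by simpa [hq] using hp
    have hlead : ∀ᵐ s : Fin n → ℂ, ∀ᵐ t : ℂ, eval (Fin.cons t s : Fin (n + 1) → ℂ) p ≠ 0 := by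
      filter_upwards [ih (Polynomial.leadingCoeff_ne_zero.mpr hq0)] with s hs
      have hmap : q.map (eval s) ≠ 0 := fun h ↦ hs <| by
        simpa [Polynomial.coeff_map] using congrArg (Polynomial.coeff · q.natDegree) h
      have hfin : {t : ℂ | (q.map (eval s)).IsRoot t}.Finite :=
        Polynomial.finite_setOfPred_isRoot hmap
      filter_upwards [hfin.countable.ae_notMem volume] with t ht h
      exact ht (by rwa [eval_eq_eval_mv_eval'] at h)
    have hcont : Continuous fun x : (Fin n → ℂ) × ℂ ↦
        eval (Fin.cons x.2 x.1 : Fin (n + 1) → ℂ) p :=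
      (continuous_eval p).comp (by fun_prop)
    have hmeas : MeasurableSet {x : (Fin n → ℂ) × ℂ |
        eval (Fin.cons x.2 x.1 : Fin (n + 1) → ℂ) p ≠ 0} :=
      (isOpen_ne_fun hcont continuous_const).measurableSet
    have hprod := (Measure.ae_prod_iff_ae_ae hmeas).mpr hlead
    have hpres := (Measure.measurePreserving_swap (μ := (volume : Measure ℂ))
      (ν := (volume : Measure (Fin n → ℂ)))).comp
      (volume_preserving_piFinSuccAbove (fun _ : Fin (n + 1) ↦ ℂ) 0)
    filter_upwards [hpres.quasiMeasurePreserving.ae hprod] with x hx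
    convert hx using 3
    simp [MeasurableEquiv.piFinSuccAbove, Fin.insertNthEquiv]

theorem ae_eval_uncurry_ne_zero {ι κ : Type*} [Fintype ι] [Fintype κ]
    {p : MvPolynomial (ι × κ) ℂ} (hp : p ≠ 0) :
    ∀ᵐ φ : ι → κ → ℂ, eval (Function.uncurry φ) p ≠ 0 := by
  let f := Fintype.equivFin (ι × κ)
  let L : (Fin (Fintype.card (ι × κ)) → ℂ) ≃L[ℝ] (ι → κ → ℂ) :=
    ((LinearEquiv.funCongrLeft ℝ ℂ f).trans (LinearEquiv.curry ℝ ℂ ι κ)).toContinuousLinearEquiv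
  have h : ∀ᵐ φ ∂(volume : Measure (Fin (Fintype.card (ι × κ)) → ℂ)).map L,
      eval (Function.uncurry φ) p ≠ 0 := by
    refine (ae_map_iff L.continuous.aemeasurable ?_).mpr ?_
    · exact (isOpen_ne_fun ((continuous_eval p).comp (by fun_prop))
        continuous_const).measurableSet
    · have hr : rename f p ≠ 0 := by
        rwa [Ne, map_eq_zero_iff _ (rename_injective f f.injective)]
      filter_upwards [ae_eval_ne_zero_fin hr] with x hx
      rw [eval_rename] at hx
      exact hx
  exact (Measure.absolutelyContinuous_isAddHaarMeasure _ _).ae_le h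

theorem ae_algebraicIndependent_uncurry {ι κ : Type*} [Fintype ι] [Fintype κ] :
    ∀ᵐ φ : ι → κ → ℂ, AlgebraicIndependent ℚ (Function.uncurry φ) := by
  have : Countable (MvPolynomial (ι × κ) ℚ) := by
    rw [← Cardinal.mk_le_aleph0_iff]
    refine cardinalMk_le_max_lift.trans ?_
    simpa using Cardinal.mk_le_aleph0 (α := ι × κ)
  have h : ∀ᵐ φ : ι → κ → ℂ, ∀ p : MvPolynomial (ι × κ) ℚ, p ≠ 0 →
      aeval (Function.uncurry φ) p ≠ 0 := by
    refine ae_all_iff.mpr fun p ↦ ?_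
    by_cases hp : p = 0
    · simp [hp]
    have hr : map (algebraMap ℚ ℂ) p ≠ 0 := by
      rwa [Ne, map_eq_zero_iff _ (map_injective _ (algebraMap ℚ ℂ).injective)]
    filter_upwards [ae_eval_uncurry_ne_zero hr] with φ hφ _
    rwa [eval_map, ← aeval_def] at hφ
  filter_upwards [h] with φ hφ
  exact algebraicIndependent_iff.mpr fun p hp ↦ by_contra fun h0 ↦ hφ p h0 hp

/-- Whether a polynomial system over a domain `R` has a solution in an algebraically closed field
does not depend on the embedding of `R` into that field. -/
theorem exists_common_zero_of_injective {R K τ ι : Type*} [CommRing R] [IsDomain R] [Field K]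
    [IsAlgClosed K] [Finite τ] {f g : R →+* K} (hf : Function.Injective f)
    (hg : Function.Injective g) (P : ι → MvPolynomial τ R)
    (h : ∃ z : τ → K, ∀ m, eval₂ f z (P m) = 0) :
    ∃ z : τ → K, ∀ m, eval₂ g z (P m) = 0 := by
  let F := FractionRing R
  let I : Ideal (MvPolynomial τ F) := Ideal.span (Set.range fun m ↦ map (algebraMap R F) (P m))
  have hlift {w : R →+* K} (hw : Function.Injective w) :
      (IsFractionRing.lift hw : F →+* K).comp (algebraMap R F) = w :=
    RingHom.ext (IsFractionRing.lift_algebraMap hw)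
  have hI : I ≠ ⊤ := by
    obtain ⟨z, hz⟩ := h
    refine ne_top_of_le_ne_top
      (RingHom.ker_ne_top (eval₂Hom (IsFractionRing.lift hf : F →+* K) z)) (Ideal.span_le.mpr ?_)
    rintro _ ⟨m, rfl⟩
    simp [RingHom.mem_ker, hlift hf, hz m]
  let : Algebra F K := (IsFractionRing.lift hg : F →+* K).toAlgebra
  obtain ⟨z, hz⟩ : (zeroLocus K I).Nonempty := by
    rw [Set.nonempty_iff_ne_empty]
    intro h0
    have hrad := vanishingIdeal_zeroLocus_eq_radical (K := K) I
    rw [h0, vanishingIdeal_empty] at hrad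
    exact hI (Ideal.radical_eq_top.mp hrad.symm)
  refine ⟨z, fun m ↦ ?_⟩
  have hzm := hz _ (Ideal.subset_span ⟨m, rfl⟩)
  rwa [aeval_def, eval₂_map, RingHom.algebraMap_toAlgebra, hlift hg] at hzm

end MvPolynomial

section Substitution

variable {k M N : ℕ}

/-- The value at `z` of the clause with neighborhood `e` and coefficients `c`. -/
noncomputable def clauseValue (e : Fin k → Fin N) (c : (Fin k → Fin 2) → ℂ) (z : Fin N → ℂ) : ℂ :=
  ∑ i : Fin k → Fin 2, c i * ∏ j : Fin k, z (e j) ^ (i j : ℕ)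

/-- The point whose coordinate at `μ m` is the constant coefficient of clause `m`, and whose
coordinates off the range of `μ` vanish. -/
noncomputable def dimerPoint (μ : Fin M → Fin N) :
    (Fin M → (Fin k → Fin 2) → ℂ) →L[ℂ] (Fin N → ℂ) :=
  ∑ m, (ContinuousLinearMap.single ℂ (fun _ ↦ ℂ) (μ m)).comp
    ((ContinuousLinearMap.proj (R := ℂ) (φ := fun _ : Fin k → Fin 2 ↦ ℂ) 0).comp
      (ContinuousLinearMap.proj (R := ℂ) (φ := fun _ : Fin M ↦ (Fin k → Fin 2) → ℂ) m))

theorem dimerPoint_apply {μ : Fin M → Fin N} (hμ : Function.Injective μ)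
    (φ : Fin M → (Fin k → Fin 2) → ℂ) (m : Fin M) : dimerPoint μ φ (μ m) = φ m 0 := by
  simp [dimerPoint, Finset.sum_apply, Pi.single_apply, hμ.eq_iff]

/-- Replace the constant coefficient of each clause by the one for which `dimerPoint μ φ`
satisfies the clause. -/
noncomputable def solvableCoeff (e : Fin M → Fin k → Fin N) (μ : Fin M → Fin N)
    (φ : Fin M → (Fin k → Fin 2) → ℂ) : Fin M → (Fin k → Fin 2) → ℂ := fun m i ↦
  if i = 0 then -∑ i' ∈ Finset.univ.erase 0, φ m i' * ∏ j, dimerPoint μ φ (e m j) ^ (i' j : ℕ)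
  else φ m i

theorem clauseValue_solvableCoeff (e : Fin M → Fin k → Fin N) (μ : Fin M → Fin N)
    (φ : Fin M → (Fin k → Fin 2) → ℂ) (m : Fin M) :
    clauseValue (e m) (solvableCoeff e μ φ m) (dimerPoint μ φ) = 0 := by
  rw [clauseValue, ← Finset.add_sum_erase _ _ (Finset.mem_univ 0)]
  have : ∀ i ∈ Finset.univ.erase (0 : Fin k → Fin 2),
      solvableCoeff e μ φ m i * ∏ j, dimerPoint μ φ (e m j) ^ (i j : ℕ) =
        φ m i * ∏ j, dimerPoint μ φ (e m j) ^ (i j : ℕ) := fun i hi ↦ by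
    rw [solvableCoeff, if_neg (Finset.ne_of_mem_erase hi)]
  rw [Finset.sum_congr rfl this]
  simp [solvableCoeff]

/-- The coefficients for which clause `m` reads `z (e m (J m)) = 0`. -/
def linearCoeff (J : Fin M → Fin k) : Fin M → (Fin k → Fin 2) → ℂ := fun m i ↦
  if i = Pi.single (J m) 1 then 1 else 0

theorem dimerPoint_linearCoeff (J : Fin M → Fin k) (μ : Fin M → Fin N) :
    dimerPoint μ (linearCoeff J) = 0 := by
  have h (m : Fin M) : (0 : Fin k → Fin 2) ≠ Pi.single (J m) 1 := fun h ↦ by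
    simpa using congrFun h (J m)
  simp [dimerPoint, linearCoeff, h]

theorem hasStrictFDerivAt_monomial_linearCoeff {e : Fin M → Fin k → Fin N} {μ : Fin M → Fin N}
    (J : Fin M → Fin k) (m : Fin M) {i : Fin k → Fin 2} (hi : i ≠ 0) :
    HasStrictFDerivAt (fun φ : Fin M → (Fin k → Fin 2) → ℂ ↦
        φ m i * ∏ j, dimerPoint μ φ (e m j) ^ (i j : ℕ))
      (linearCoeff J m i •
        (ContinuousLinearMap.proj (R := ℂ) (φ := fun _ : Fin N ↦ ℂ) (e m (J m))).comp
          (dimerPoint μ)) (linearCoeff J) := by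
  obtain ⟨j₀, hj₀⟩ := Function.ne_iff.mp hi
  have hij : i j₀ = 1 := Fin.eq_one_of_ne_zero _ hj₀
  have hsplit : (fun φ : Fin M → (Fin k → Fin 2) → ℂ ↦
      φ m i * ∏ j, dimerPoint μ φ (e m j) ^ (i j : ℕ)) = fun φ ↦
      (φ m i * ∏ j ∈ Finset.univ.erase j₀, dimerPoint μ φ (e m j) ^ (i j : ℕ)) *
        dimerPoint μ φ (e m j₀) := by
    funext φ
    rw [← Finset.mul_prod_erase _ _ (Finset.mem_univ j₀), hij]
    simp only [Fin.val_one, pow_one]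
    ring
  have hfac : ContDiff ℂ 1 fun φ : Fin M → (Fin k → Fin 2) → ℂ ↦
      φ m i * ∏ j ∈ Finset.univ.erase j₀, dimerPoint μ φ (e m j) ^ (i j : ℕ) := by
    fun_prop
  have hlin := ((ContinuousLinearMap.proj (R := ℂ) (φ := fun _ : Fin N ↦ ℂ) (e m j₀)).comp
    (dimerPoint (k := k) μ)).hasStrictFDerivAt (x := linearCoeff J)
  rw [hsplit]
  refine ((hfac.contDiffAt.hasStrictFDerivAt one_ne_zero).mul hlin).congr_fderiv ?_
  by_cases h : i = Pi.single (J m) 1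
  · have hj : j₀ = J m := by
      by_contra hne
      simp [h, hne] at hij
    subst hj
    have hprod : ∏ j ∈ Finset.univ.erase (J m),
        dimerPoint μ (linearCoeff J) (e m j) ^ (i j : ℕ) = 1 :=
      Finset.prod_eq_one fun j hj ↦ by simp [h, Finset.ne_of_mem_erase hj]
    simp only [hprod, mul_one]
    exact ContinuousLinearMap.ext fun δ ↦ by simp [dimerPoint_linearCoeff]
  · exact ContinuousLinearMap.ext fun δ ↦ by simp [linearCoeff, h, dimerPoint_linearCoeff]

/-- Negation of the constant coefficients. -/
noncomputable def negConst : (Fin M → (Fin k → Fin 2) → ℂ) →L[ℂ] (Fin M → (Fin k → Fin 2) → ℂ) :=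
  ContinuousLinearMap.pi fun m ↦ ContinuousLinearMap.pi fun i ↦ (if i = 0 then -1 else 1 : ℂ) •
    (ContinuousLinearMap.proj (R := ℂ) (φ := fun _ : Fin k → Fin 2 ↦ ℂ) i).comp
      (ContinuousLinearMap.proj (R := ℂ) (φ := fun _ : Fin M ↦ (Fin k → Fin 2) → ℂ) m)

theorem negConst_apply (φ : Fin M → (Fin k → Fin 2) → ℂ) (m : Fin M) (i : Fin k → Fin 2) :
    negConst φ m i = (if i = 0 then -1 else 1 : ℂ) * φ m i := rfl

theorem negConst_surjective : Function.Surjective (negConst (k := k) (M := M)) := fun φ ↦ by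
  refine ⟨negConst φ, ?_⟩
  ext m i
  rw [negConst_apply, negConst_apply]
  split_ifs <;> ring

theorem hasStrictFDerivAt_solvableCoeff {e : Fin M → Fin k → Fin N} {μ : Fin M → Fin N}
    (hμ : Function.Injective μ) {J : Fin M → Fin k} (hJ : ∀ m, e m (J m) = μ m) :
    HasStrictFDerivAt (solvableCoeff e μ) negConst (linearCoeff J) := by
  refine hasStrictFDerivAt_pi'.mpr fun m ↦ hasStrictFDerivAt_pi'.mpr fun i ↦ ?_
  by_cases hi : i = 0
  · subst hi
    have hsum := (HasStrictFDerivAt.fun_sum (u := Finset.univ.erase (0 : Fin k → Fin 2))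
      fun i hi ↦ hasStrictFDerivAt_monomial_linearCoeff (e := e) (μ := μ) J m
        (Finset.ne_of_mem_erase hi)).neg
    have hne : (Pi.single (J m) 1 : Fin k → Fin 2) ≠ 0 := by simp
    simp only [solvableCoeff, if_true]
    refine hsum.congr_fderiv ?_
    ext φ
    have hterm (i : Fin k → Fin 2) : (linearCoeff J m i •
        (ContinuousLinearMap.proj (R := ℂ) (φ := fun _ : Fin N ↦ ℂ) (e m (J m))).comp
          (dimerPoint μ)) φ = if i = Pi.single (J m) 1 then φ m 0 else 0 := by
      rw [smul_apply, ContinuousLinearMap.comp_apply,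
        ContinuousLinearMap.proj_apply, hJ, dimerPoint_apply hμ, linearCoeff, ite_smul, one_smul,
        zero_smul]
    simp only [neg_apply, sum_apply, hterm,
      ContinuousLinearMap.comp_apply, ContinuousLinearMap.proj_apply, negConst_apply]
    simp [-Finset.sum_erase_eq_sub, hne]
  · simp only [solvableCoeff, if_neg hi]
    refine ((ContinuousLinearMap.proj (R := ℂ) (φ := fun _ : Fin k → Fin 2 ↦ ℂ) i).comp
      (ContinuousLinearMap.proj (R := ℂ) (φ := fun _ : Fin M ↦ (Fin k → Fin 2) → ℂ)
        m)).hasStrictFDerivAt.congr_fderiv ?_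
    ext φ
    simp [negConst_apply, hi]

/-- Some solvable system has coefficients that are algebraically independent over `ℚ`. -/
theorem exists_algebraicIndependent_solvable {e : Fin M → Fin k → Fin N} {μ : Fin M → Fin N}
    (hμ : Function.Injective μ) (hcov : ∀ m, ∃ j, e m j = μ m) :
    ∃ φ : Fin M → (Fin k → Fin 2) → ℂ, AlgebraicIndependent ℚ (Function.uncurry φ) ∧
      ∃ z, ∀ m, clauseValue (e m) (φ m) z = 0 := by
  choose J hJ using hcov
  have hnhds := (hasStrictFDerivAt_solvableCoeff hμ hJ).map_nhds_eq_of_surj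
    (LinearMap.range_eq_top.mpr negConst_surjective)
  have hrange : Set.range (solvableCoeff e μ) ∈ nhds (solvableCoeff e μ (linearCoeff J)) :=
    hnhds ▸ Filter.range_mem_map
  have : Measure.IsOpenPosMeasure (volume : Measure ((Fin k → Fin 2) → ℂ)) := inferInstance
  have : Measure.IsOpenPosMeasure (volume : Measure (Fin M → (Fin k → Fin 2) → ℂ)) := inferInstance
  obtain ⟨_, hφ, φ, rfl⟩ := (Measure.dense_of_ae (MvPolynomial.ae_algebraicIndependent_uncurry
    (ι := Fin M) (κ := Fin k → Fin 2))).inter_nhds_nonempty hrange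
  exact ⟨_, hφ, _, clauseValue_solvableCoeff e μ φ⟩

end Substitution

/-- The clause with neighborhood `e` as a polynomial with indeterminate coefficients. -/
noncomputable def clausePolynomial {k M N : ℕ} (e : Fin M → Fin k → Fin N) (m : Fin M) :
    MvPolynomial (Fin N) (MvPolynomial (Fin M × (Fin k → Fin 2)) ℚ) :=
  ∑ i : Fin k → Fin 2, MvPolynomial.C (MvPolynomial.X (m, i)) *
    ∏ j : Fin k, MvPolynomial.X (e m j) ^ (i j : ℕ)

theorem eval₂_clausePolynomial {k M N : ℕ} (e : Fin M → Fin k → Fin N) (m : Fin M)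
    (φ : Fin M → (Fin k → Fin 2) → ℂ) (z : Fin N → ℂ) :
    MvPolynomial.eval₂ (MvPolynomial.aeval (Function.uncurry φ) : _ →ₐ[ℚ] ℂ).toRingHom z
      (clausePolynomial e m) = clauseValue (e m) (φ m) z := by
  rw [← MvPolynomial.coe_eval₂Hom]
  simp [clausePolynomial, clauseValue, map_sum]

/-- If a k-QSAT system admits a clause-covering dimer configuration, then for almost
every choice of coefficients the polynomial system has a common solution. -/
theorem prodsat_of_dimer_covering (k M N : ℕ) (hk : 0 < k) (hM : 0 < M) (hN : 0 < N)
    (e : Fin M → Fin k → Fin N) (he : ∀ m, Function.Injective (e m))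
    (μ : Fin M → Fin N) (hμ : Function.Injective μ)
    (hcov : ∀ m : Fin M, ∃ j : Fin k, e m j = μ m) :
    ∀ᵐ φ : Fin M → ((Fin k → Fin 2) → ℂ) ∂volume,
      ∃ z : Fin N → ℂ, ∀ m : Fin M,
        ∑ i : Fin k → Fin 2, φ m i * ∏ j : Fin k, (z (e m j)) ^ ((i j : ℕ)) = 0 := by
  obtain ⟨φ₀, hφ₀, hz⟩ := exists_algebraicIndependent_solvable hμ hcov
  filter_upwards [MvPolynomial.ae_algebraicIndependent_uncurry] with φ hφ
  have h := MvPolynomial.exists_common_zero_of_injective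
    (f := (MvPolynomial.aeval (Function.uncurry φ₀) : _ →ₐ[ℚ] ℂ).toRingHom)
    (g := (MvPolynomial.aeval (Function.uncurry φ) : _ →ₐ[ℚ] ℂ).toRingHom)
    hφ₀ hφ (clausePolynomial e)
  simp only [eval₂_clausePolynomial] at h
  exact h hz
end

section
/- Consider a k-QSAT polynomial system with M clauses on N variables given by a neighborhood map e : Fin M → Fin k → Fin N with e m injective for every m, and suppose it admits NO clause-covering dimer configuration, i.e., there is no injective map μ : Fin M → Fin N with, for every m, some j : Fin k such that e m j = μ m. Then for volume-almost every choice of coefficients φ : Fin M → ((Fin k → Fin 2) → ℂ), there exists no z : Fin N → ℂ satisfying all the equations ∑_{i : Fin k → Fin 2} φ m i * ∏_{j : Fin k} (z (e m j)) ^ ((i j : ℕ)) = 0 for every m : Fin M. -/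
open MeasureTheory

/-- A differentiable self-map of a finite-dimensional real space that is invariant under
translations along a nonzero direction has null range. -/
theorem addHaar_range_eq_zero_of_translation_invariant {E : Type*} [NormedAddCommGroup E]
    [NormedSpace ℝ E] [FiniteDimensional ℝ E] [MeasurableSpace E] [BorelSpace E]
    (μ : Measure E) [μ.IsAddHaarMeasure] {f : E → E} (hf : Differentiable ℝ f)
    {v : E} (hv : v ≠ 0) (hfv : ∀ (x : E) (t : ℝ), f (x + t • v) = f x) :
    μ (Set.range f) = 0 := by
  rw [← Set.image_univ]
  refine addHaar_image_eq_zero_of_det_fderivWithin_eq_zero μ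
    (fun x _ => (hf x).hasFDerivAt.hasFDerivWithinAt) fun x _ => ?_
  have hker : fderiv ℝ f x v = 0 := by
    rw [← (hf x).lineDeriv_eq_fderiv, lineDeriv]
    simp [hfv]
  by_contra hdet
  exact hv ((LinearMap.equivOfDetNeZero (fderiv ℝ f x : E →ₗ[ℝ] E) hdet).injective
    (by simpa using hker))

/-- The violation of Hall's condition when there is no dimer covering: after removing one
clause `s₀`, the variables adjacent to `S` still inject into the clauses of `S`. -/
theorem exists_injOn_neighbors_of_no_covering {k M N : ℕ} (e : Fin M → Fin k → Fin N)
    (hnocov : ¬ ∃ μ : Fin M → Fin N, Function.Injective μ ∧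
      ∀ m : Fin M, ∃ j : Fin k, e m j = μ m) :
    ∃ (S : Set (Fin M)) (Γ : Set (Fin N)) (s₀ : Fin M) (g : Fin N → Fin M),
      s₀ ∈ S ∧ (∀ m ∈ S, ∀ j, e m j ∈ Γ) ∧ Set.MapsTo g Γ (S \ {s₀}) ∧ Set.InjOn g Γ := by
  classical
  have hall := Finset.all_card_le_biUnion_card_iff_exists_injective
    fun m => Finset.univ.image (e m)
  simp only [Finset.mem_image, Finset.mem_univ, true_and] at hall
  rw [← hall] at hnocov
  push Not at hnocov
  obtain ⟨S, hS⟩ := hnocov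
  obtain ⟨s₀, hs₀⟩ := Finset.card_pos.mp (Nat.zero_lt_of_lt hS)
  have : Nonempty (Fin M) := ⟨s₀⟩
  set Γ := S.biUnion fun m => Finset.univ.image (e m)
  obtain ⟨g, hg, hinj⟩ := Γ.finite_toSet.exists_injOn_of_encard_le
    (t := ((S.erase s₀ : Finset (Fin M)) : Set (Fin M))) (by
      rw [Set.encard_coe_eq_coe_finsetCard, Set.encard_coe_eq_coe_finsetCard,
        Finset.card_erase_of_mem hs₀]
      exact_mod_cast Nat.le_sub_one_of_lt hS)
  refine ⟨S, Γ, s₀, g, hs₀, fun m hm j => ?_, fun n hn => ?_, hinj⟩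
  · exact Finset.mem_coe.mpr
      (Finset.mem_biUnion.mpr ⟨m, hm, Finset.mem_image_of_mem _ (Finset.mem_univ j)⟩)
  · simpa [and_comm] using hg hn

open Classical in
/-- Reads the values of the variables `n` in `Γ` off the constant coefficients of the clauses
`g n`, and then replaces the constant coefficients of the clauses in `S` by the unique values for
which these clauses are satisfied. -/
noncomputable def solveConstantCoeffs {k M N : ℕ} (e : Fin M → Fin k → Fin N)
    (S : Set (Fin M)) (Γ : Set (Fin N)) (g : Fin N → Fin M)
    (ψ : Fin M → (Fin k → Fin 2) → ℂ) (m : Fin M) (i : Fin k → Fin 2) : ℂ :=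
  if m ∈ S ∧ i = 0 then
    -∑ i' ∈ Finset.univ.erase 0, ψ m i' *
      ∏ j, (if e m j ∈ Γ then ψ (g (e m j)) 0 else 0) ^ (i' j : ℕ)
  else ψ m i

section solveConstantCoeffs

variable {k M N : ℕ} {e : Fin M → Fin k → Fin N} {S : Set (Fin M)} {Γ : Set (Fin N)}
  {g : Fin N → Fin M}

theorem contDiff_solveConstantCoeffs : ContDiff ℝ 1 (solveConstantCoeffs e S Γ g) := by
  refine contDiff_pi.mpr fun m => contDiff_pi.mpr fun i => ?_
  have hcoord (m : Fin M) (i : Fin k → Fin 2) :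
      ContDiff ℝ 1 fun ψ : Fin M → (Fin k → Fin 2) → ℂ => ψ m i := by fun_prop
  unfold solveConstantCoeffs
  split_ifs
  · refine (ContDiff.sum fun i' _ => (hcoord m i').mul ?_).neg
    refine contDiff_prod fun j _ => ?_
    split_ifs
    · exact (hcoord _ 0).pow _
    · fun_prop
  · exact hcoord m i

theorem solveConstantCoeffs_add_smul {s₀ : Fin M} (hs₀ : s₀ ∈ S)
    (hg : Set.MapsTo g Γ (S \ {s₀})) (ψ : Fin M → (Fin k → Fin 2) → ℂ) (t : ℝ) :
    solveConstantCoeffs e S Γ g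
        (ψ + t • (Pi.single s₀ (Pi.single 0 1) : Fin M → (Fin k → Fin 2) → ℂ)) =
      solveConstantCoeffs e S Γ g ψ := by
  have hcoord {m : Fin M} {i : Fin k → Fin 2} (h : m ≠ s₀ ∨ i ≠ 0) :
      (ψ + t • (Pi.single s₀ (Pi.single 0 1) : Fin M → (Fin k → Fin 2) → ℂ)) m i = ψ m i := by
    obtain h | h := h
    · simp [h]
    · obtain rfl | hm := eq_or_ne m s₀ <;> simp [*]
  funext m i
  unfold solveConstantCoeffs
  split_ifs with h
  · congr 1
    refine Finset.sum_congr rfl fun i' hi' => ?_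
    rw [hcoord (.inr (Finset.ne_of_mem_erase hi'))]
    congr 1
    refine Finset.prod_congr rfl fun j _ => ?_
    split_ifs with hj
    · rw [hcoord (.inl (hg hj).2)]
    · rfl
  · refine hcoord ?_
    by_contra! hmi
    exact h ⟨hmi.1 ▸ hs₀, hmi.2⟩

theorem mem_range_solveConstantCoeffs [Nonempty (Fin N)] (hΓ : ∀ m ∈ S, ∀ j, e m j ∈ Γ)
    (hg : Set.MapsTo g Γ S) (hinj : Set.InjOn g Γ)
    {φ : Fin M → (Fin k → Fin 2) → ℂ} {z : Fin N → ℂ}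
    (hz : ∀ m, ∑ i : Fin k → Fin 2, φ m i * ∏ j : Fin k, (z (e m j)) ^ ((i j : ℕ)) = 0) :
    φ ∈ Set.range (solveConstantCoeffs e S Γ g) := by
  classical
  refine ⟨fun m i => if m ∈ S ∧ i = 0 then z (Function.invFunOn g Γ m) else φ m i, ?_⟩
  funext m i
  rw [solveConstantCoeffs]
  by_cases h : m ∈ S ∧ i = 0
  · rw [if_pos h]
    obtain ⟨hm, rfl⟩ := h
    rw [neg_eq_iff_add_eq_zero, ← hz m, ← Finset.sum_erase_add _ _ (Finset.mem_univ 0)]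
    congr 1
    · refine Finset.sum_congr rfl fun i' hi' => ?_
      rw [if_neg fun h : m ∈ S ∧ i' = 0 => Finset.ne_of_mem_erase hi' h.2]
      congr 1
      refine Finset.prod_congr rfl fun j _ => ?_
      have hj := hΓ m hm j
      rw [if_pos hj, if_pos ⟨hg hj, rfl⟩, hinj.leftInvOn_invFunOn hj]
    · simp
  · simp only [if_neg h]

end solveConstantCoeffs

/-- If a k-QSAT system admits no clause-covering dimer configuration, then for almost
every choice of coefficients the polynomial system has no common solution. -/
theorem no_prodsat_of_no_dimer_covering (k M N : ℕ) (hk : 0 < k) (hM : 0 < M) (hN : 0 < N)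
    (e : Fin M → Fin k → Fin N) (he : ∀ m, Function.Injective (e m))
    (hnocov : ¬ ∃ μ : Fin M → Fin N, Function.Injective μ ∧
      ∀ m : Fin M, ∃ j : Fin k, e m j = μ m) :
    ∀ᵐ φ : Fin M → ((Fin k → Fin 2) → ℂ) ∂volume,
      ¬ ∃ z : Fin N → ℂ, ∀ m : Fin M,
        ∑ i : Fin k → Fin 2, φ m i * ∏ j : Fin k, (z (e m j)) ^ ((i j : ℕ)) = 0 := by
  obtain ⟨S, Γ, s₀, g, hs₀, hΓ, hg, hinj⟩ := exists_injOn_neighbors_of_no_covering e hnocov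
  have : Nonempty (Fin N) := ⟨⟨0, hN⟩⟩
  have hv : (Pi.single s₀ (Pi.single 0 1) : Fin M → (Fin k → Fin 2) → ℂ) ≠ 0 := by simp
  have : (volume : Measure ((Fin k → Fin 2) → ℂ)).IsAddHaarMeasure :=
    Measure.pi.isAddHaarMeasure _
  have : (volume : Measure (Fin M → (Fin k → Fin 2) → ℂ)).IsAddHaarMeasure :=
    Measure.pi.isAddHaarMeasure _
  have hnull : volume (Set.range (solveConstantCoeffs e S Γ g)) = 0 :=
    addHaar_range_eq_zero_of_translation_invariant volume
      (contDiff_solveConstantCoeffs.differentiable one_ne_zero) hv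
      (solveConstantCoeffs_add_smul hs₀ hg)
  filter_upwards [measure_eq_zero_iff_ae_notMem.mp hnull] with φ hφ
  rintro ⟨z, hz⟩
  exact hφ (mem_range_solveConstantCoeffs hΓ (hg.mono_right Set.sdiff_subset) hinj hz)
end

section
/- Let d, d', p be natural numbers and let A : Matrix (Fin d) (Fin d') (MvPolynomial (Fin p) ℂ) be a matrix whose entries are multivariate polynomials over ℂ in p parameters. Then for volume-almost every parameter point x : Fin p → ℂ, the rank of the evaluated complex matrix A.map (MvPolynomial.eval x) equals the supremum over all parameter points y : Fin p → ℂ of the rank of A.map (MvPolynomial.eval y). That is, a matrix depending polynomially on parameters attains its maximal (generic) rank at almost every parameter value. -/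
open MeasureTheory

theorem MvPolynomial.ae_eval_ne_zero {p : ℕ} {q : MvPolynomial (Fin p) ℂ} (hq : q ≠ 0) :
    ∀ᵐ x : Fin p → ℂ, MvPolynomial.eval x q ≠ 0 := by
  induction p with
  | zero =>
    refine Filter.Eventually.of_forall fun x hx => hq ?_
    refine MvPolynomial.funext fun y => ?_
    rw [Subsingleton.elim y x, hx, map_zero]
  | succ n ih =>
    set P := MvPolynomial.finSuccEquiv ℂ n q with hP
    have hP0 : P ≠ 0 := by simpa [hP] using hq
    have hmp := (volume_preserving_piFinSuccAbove (fun _ : Fin (n + 1) => ℂ) 0).symm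
    have hmeas : MeasurableSet {x : Fin (n + 1) → ℂ | MvPolynomial.eval x q ≠ 0} :=
      ((MvPolynomial.continuous_eval q).measurable (measurableSet_singleton 0)).compl
    rw [← hmp.map_eq, ae_map_iff hmp.measurable.aemeasurable hmeas]
    have hmeas' := hmp.measurable hmeas
    rw [Measure.volume_eq_prod, ← Measure.prod_swap,
      ae_map_iff measurable_swap.aemeasurable (p := fun z => _ ≠ _) hmeas']
    refine (Measure.ae_prod_iff_ae_ae (measurable_swap hmeas')).2 ?_
    filter_upwards [ih (Polynomial.leadingCoeff_ne_zero.2 hP0)] with s hs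
    have hmap : P.map (MvPolynomial.eval s) ≠ 0 := fun h => hs <| by
      simpa [Polynomial.coeff_map] using congrArg (Polynomial.coeff · P.natDegree) h
    filter_upwards [(Polynomial.finite_setOfPred_isRoot hmap).countable.ae_notMem volume]
      with z hz h0
    refine hz ?_
    have hz' : MvPolynomial.eval (Fin.cons z s : Fin (n + 1) → ℂ) q = 0 := by
      simpa [MeasurableEquiv.piFinSuccAbove, Fin.insertNthEquiv] using h0
    rwa [MvPolynomial.eval_eq_eval_mv_eval'] at hz'

theorem Matrix.exists_mul_mul_eq_one {K : Type*} [Field K] {m n : ℕ}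
    (M : Matrix (Fin m) (Fin n) K) :
    ∃ (B : Matrix (Fin M.rank) (Fin m) K) (C : Matrix (Fin n) (Fin M.rank) K),
      B * M * C = 1 := by
  let f := Matrix.toLin' M
  let e : LinearMap.range f ≃ₗ[K] (Fin M.rank → K) :=
    (Module.finBasisOfFinrankEq K (LinearMap.range f) rfl).equivFun
  obtain ⟨s, hs⟩ := f.rangeRestrict.exists_rightInverse_of_surjective f.range_rangeRestrict
  obtain ⟨g, hg⟩ := (LinearMap.range f).subtype.exists_leftInverse_of_injective
    (Submodule.ker_subtype _)
  refine ⟨LinearMap.toMatrix' (e.toLinearMap ∘ₗ g), LinearMap.toMatrix' (s ∘ₗ e.symm.toLinearMap),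
    Matrix.toLin'.injective ?_⟩
  simp only [Matrix.toLin'_mul, Matrix.toLin'_toMatrix', Matrix.toLin'_one]
  refine LinearMap.ext fun v => ?_
  have h1 (w) : f (s w) = w := congrArg Subtype.val (LinearMap.congr_fun hs w)
  have h2 (w : LinearMap.range f) : g w = w := LinearMap.congr_fun hg w
  change e (g (f (s (e.symm v)))) = v
  rw [h1, h2]
  simp

/-- A matrix depending polynomially on parameters attains its maximal (generic) rank
at almost every parameter value. -/
theorem generic_rank_attained_ae (d d' p : ℕ)
    (A : Matrix (Fin d) (Fin d') (MvPolynomial (Fin p) ℂ)) :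
    ∀ᵐ x : Fin p → ℂ ∂volume,
      (A.map (MvPolynomial.eval x)).rank
        = ⨆ y : Fin p → ℂ, (A.map (MvPolynomial.eval y)).rank := by
  have hbdd : BddAbove (Set.range fun y : Fin p → ℂ => (A.map (MvPolynomial.eval y)).rank) :=
    ⟨d, by rintro _ ⟨y, rfl⟩; exact Matrix.rank_le_height _⟩
  obtain ⟨y, hy⟩ := Nat.sSup_mem (Set.range_nonempty _) hbdd
  obtain ⟨B, C, hBC⟩ := (A.map (MvPolynomial.eval y)).exists_mul_mul_eq_one
  let B' : Matrix _ _ (MvPolynomial (Fin p) ℂ) := B.map MvPolynomial.C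
  let C' : Matrix _ _ (MvPolynomial (Fin p) ℂ) := C.map MvPolynomial.C
  let Q := B' * A * C'
  have hQ (x : Fin p → ℂ) :
      MvPolynomial.eval x Q.det = (B * A.map (MvPolynomial.eval x) * C).det := by
    rw [RingHom.map_det]
    congr 1
    simp [Q, B', C', Matrix.map_mul, Function.comp_def]
  have hQ0 : Q.det ≠ 0 := fun h => by simpa [hBC, h] using hQ y
  filter_upwards [MvPolynomial.ae_eval_ne_zero hQ0] with x hx
  refine le_antisymm (le_ciSup hbdd x) ?_
  rw [hQ] at hx
  change sSup _ ≤ _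
  rw [← hy]
  calc (A.map (MvPolynomial.eval y)).rank
      = (B * A.map (MvPolynomial.eval x) * C).rank := by
        rw [Matrix.rank_of_isUnit _ ((Matrix.isUnit_iff_isUnit_det _).2 hx.isUnit),
          Fintype.card_fin]
    _ ≤ (B * A.map (MvPolynomial.eval x)).rank := Matrix.rank_mul_le_left _ _
    _ ≤ _ := Matrix.rank_mul_le_right _ _
end

section
/- Let d, p be natural numbers and let A : Matrix (Fin d) (Fin d) (MvPolynomial (Fin p) ℂ) be a square matrix whose entries are multivariate polynomials over ℂ in p parameters. Then for volume-almost every parameter point x : Fin p → ℂ, the dimension (finrank over ℂ) of the kernel of the linear map (A.map (MvPolynomial.eval x)).mulVecLin equals the infimum over all parameter points y : Fin p → ℂ of the kernel dimension of (A.map (MvPolynomial.eval y)).mulVecLin. In particular, the zero-eigenvalue eigenspace of a Hamiltonian matrix depending polynomially on the projector coefficients has, with probability one, the minimal possible dimension 2^N − S, where S is the generic rank. -/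
open MeasureTheory

/-- A nonzero multivariate polynomial is nonzero almost everywhere for any power of an atomless
σ-finite measure. -/
theorem MvPolynomial.ae_eval_ne_zero_s12 {K : Type*} [Field K] [TopologicalSpace K]
    [IsTopologicalRing K] [T1Space K] [SecondCountableTopology K] [MeasurableSpace K]
    [BorelSpace K] (μ : Measure K) [SigmaFinite μ] [NullSingletonClass μ] {n : ℕ}
    {f : MvPolynomial (Fin n) K} (hf : f ≠ 0) :
    ∀ᵐ x ∂Measure.pi fun _ : Fin n => μ, eval x f ≠ 0 := by
  induction n with
  | zero =>
    refine .of_forall fun x hx => hf ?_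
    obtain ⟨c, rfl⟩ := C_surjective (Fin 0) f
    simpa using hx
  | succ n ih =>
    have hmeas : MeasurableSet {z : (Fin n → K) × K | eval (Fin.cons z.2 z.1) f ≠ 0} := by
      refine (isOpen_ne.preimage ?_).measurableSet
      refine (MvPolynomial.continuous_eval f).comp ?_
      fun_prop
    have hg : finSuccEquiv K n f ≠ 0 := by simpa using hf
    have hprod : ∀ᵐ z ∂(Measure.pi fun _ : Fin n => μ).prod μ,
        eval (Fin.cons z.2 z.1) f ≠ 0 := by
      rw [Measure.ae_prod_iff_ae_ae hmeas]
      filter_upwards [ih (Polynomial.leadingCoeff_ne_zero.mpr hg)] with s hs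
      have hmap : (finSuccEquiv K n f).map (eval s) ≠ 0 := fun h => hs <| by
        simpa [Polynomial.coeff_map] using
          congrArg (Polynomial.coeff · (finSuccEquiv K n f).natDegree) h
      refine measure_mono_null ?_
        (((finSuccEquiv K n f).map (eval s)).rootSet_finite K |>.measure_zero μ)
      intro y hy
      have hy : eval (Fin.cons y s) f = 0 := by simpa using hy
      rw [eval_eq_eval_mv_eval'] at hy
      simpa [Polynomial.mem_rootSet, hmap] using hy
    have hpi := measurePreserving_piFinSuccAbove (fun _ : Fin (n + 1) => μ) 0
    have hswap := (Measure.measurePreserving_swap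
      (μ := μ) (ν := Measure.pi fun _ : Fin n => μ)).comp hpi
    filter_upwards [hswap.quasiMeasurePreserving.ae hprod] with x hx
    convert hx using 3
    exact (Fin.cons_self_tail x).symm

/-- The identity is the sum of a map factoring through `f` and one factoring through `ker f`. -/
theorem LinearMap.exists_comp_add_comp_eq_id {K V W : Type*} [Field K] [AddCommGroup V]
    [Module K V] [AddCommGroup W] [Module K W] (f : V →ₗ[K] W) :
    ∃ (u : W →ₗ[K] V) (r : V →ₗ[K] ker f) (w : ker f →ₗ[K] V),
      u ∘ₗ f + w ∘ₗ r = LinearMap.id := by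
  obtain ⟨r, hr⟩ := (ker f).subtype.exists_leftInverse_of_injective (by simp)
  have hinj : ker (f.prod r) = ⊥ := by
    refine ker_eq_bot'.mpr fun x hx => ?_
    obtain ⟨hfx, hrx⟩ : f x = 0 ∧ r x = 0 := by simpa using hx
    have hx' : r x = ⟨x, hfx⟩ := LinearMap.congr_fun hr ⟨x, hfx⟩
    exact congrArg Subtype.val (hx'.symm.trans hrx)
  obtain ⟨l, hl⟩ := (f.prod r).exists_leftInverse_of_injective hinj
  refine ⟨l ∘ₗ inl K W (ker f), r, l ∘ₗ inr K W (ker f), ?_⟩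
  rw [← hl]
  ext x
  simp [← map_add]

/-- The kernel dimension of a matrix of polynomials is almost everywhere at most its value at
any given point. -/
theorem Matrix.ae_finrank_ker_eval_le {K : Type*} [Field K] [TopologicalSpace K]
    [IsTopologicalRing K] [T1Space K] [SecondCountableTopology K] [MeasurableSpace K]
    [BorelSpace K] (μ : Measure K) [SigmaFinite μ] [NullSingletonClass μ] {n : ℕ}
    {ι : Type*} [Fintype ι]
    (A : Matrix ι ι (MvPolynomial (Fin n) K)) (y : Fin n → K) :
    ∀ᵐ x ∂Measure.pi fun _ : Fin n => μ,
      Module.finrank K (LinearMap.ker (A.map (MvPolynomial.eval x)).mulVecLin)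
        ≤ Module.finrank K (LinearMap.ker (A.map (MvPolynomial.eval y)).mulVecLin) := by
  classical
  obtain ⟨u, r, w, hurw⟩ :=
    (A.map (MvPolynomial.eval y)).mulVecLin.exists_comp_add_comp_eq_id
  let B : Matrix ι ι (MvPolynomial (Fin n) K) :=
    (LinearMap.toMatrix' u).map MvPolynomial.C * A +
      (LinearMap.toMatrix' (w ∘ₗ r)).map MvPolynomial.C
  have hB (x : Fin n → K) : B.map (MvPolynomial.eval x) =
      LinearMap.toMatrix' u * A.map (MvPolynomial.eval x) + LinearMap.toMatrix' (w ∘ₗ r) := by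
    ext i j
    simp [B, Matrix.mul_apply]
  have hdet (x : Fin n → K) :
      MvPolynomial.eval x B.det = (B.map (MvPolynomial.eval x)).det :=
    RingHom.map_det _ _
  have hBy : B.map (MvPolynomial.eval y) = 1 := by
    rw [hB, ← LinearMap.toMatrix'_id, ← hurw, map_add, LinearMap.toMatrix'_comp,
      show LinearMap.toMatrix' (A.map (MvPolynomial.eval y)).mulVecLin = _ from
        LinearMap.toMatrix'_toLin' _]
  have hB0 : B.det ≠ 0 := fun h => by
    simpa [h, hBy] using hdet y
  filter_upwards [MvPolynomial.ae_eval_ne_zero_s12 μ hB0] with x hx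
  refine LinearMap.finrank_le_finrank_of_injective
    (f := r ∘ₗ (LinearMap.ker (A.map (MvPolynomial.eval x)).mulVecLin).subtype) ?_
  rw [← LinearMap.ker_eq_bot, LinearMap.ker_eq_bot']
  rintro ⟨v, hv⟩ hrv
  have hrv : r v = 0 := hrv
  have hv : (A.map (MvPolynomial.eval x)).mulVec v = 0 := by simpa using hv
  rw [Subtype.ext_iff]
  refine Matrix.eq_zero_of_mulVec_eq_zero (M := B.map (MvPolynomial.eval x)) (hdet x ▸ hx) ?_
  rw [hB, Matrix.add_mulVec, ← Matrix.mulVec_mulVec, hv, Matrix.mulVec_zero, zero_add,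
    LinearMap.toMatrix'_mulVec, LinearMap.comp_apply, hrv, map_zero]

/-- The kernel of a square matrix depending polynomially on parameters has, at almost
every parameter value, the minimal possible (generic) dimension. -/
theorem generic_kernel_dimension_ae (d p : ℕ)
    (A : Matrix (Fin d) (Fin d) (MvPolynomial (Fin p) ℂ)) :
    ∀ᵐ x : Fin p → ℂ ∂volume,
      Module.finrank ℂ (LinearMap.ker (A.map (MvPolynomial.eval x)).mulVecLin)
        = ⨅ y : Fin p → ℂ,
            Module.finrank ℂ (LinearMap.ker (A.map (MvPolynomial.eval y)).mulVecLin) := by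
  obtain ⟨y, hy⟩ := Nat.sInf_mem (Set.range_nonempty fun y : Fin p → ℂ =>
    Module.finrank ℂ (LinearMap.ker (A.map (MvPolynomial.eval y)).mulVecLin))
  filter_upwards [Matrix.ae_finrank_ker_eval_le volume A y] with x hx
  exact le_antisymm (hx.trans_eq hy) (Nat.sInf_le ⟨x, rfl⟩)
end
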